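/- (Gale's evenness condition for the almost cyclic polytope.) Let d ≥ 2, s ≥ 0, n > d+s, let C(d,n,s) = conv{y(t_1), …, y(t_n)} be the almost cyclic polytope, and set T = {t_1, …, t_n}, I = {t_1, …, t_{d+s}}. Let S ⊆ T be a d-element subset with S ⊄ I. Then conv{y(t) : t ∈ S} is a facet of C(d,n,s) if and only if for any two elements u, v ∈ T∖S, the number of elements t ∈ S with u < t < v is even. -/

import Mathlib

open Finset

namespace ASP

noncomputable section

/-- The dot product of two vectors in `ℝ^d`. -/
def dotp {d : ℕ} (x y : Fin d → ℝ) : ℝ := ∑ i, x i * y i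

/-- `F` is a face of the polytope `P ⊆ ℝ^d`: the intersection of `P` with a supporting
hyperplane, together with the empty face and `P` itself. -/
def IsFaceOf {d : ℕ} (P F : Set (Fin d → ℝ)) : Prop :=
  F = ∅ ∨ F = P ∨
    ∃ (b : Fin d → ℝ) (c : ℝ), b ≠ 0 ∧ (∀ x ∈ P, dotp b x ≤ c) ∧
      F = {x ∈ P | dotp b x = c}

/-- The dimension of a subset of `ℝ^d`: the dimension of its affine span. -/
def polyDim {d : ℕ} (S : Set (Fin d → ℝ)) : ℕ :=
  Module.finrank ℝ (affineSpan ℝ S).direction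

/-- A polytope: the convex hull of a finite point set. -/
def IsPolytope {d : ℕ} (P : Set (Fin d → ℝ)) : Prop :=
  ∃ V : Finset (Fin d → ℝ), P = convexHull ℝ (V : Set (Fin d → ℝ))

/-- The vertex set of a polytope: its set of extreme points. -/
def verts {d : ℕ} (P : Set (Fin d → ℝ)) : Set (Fin d → ℝ) :=
  Set.extremePoints ℝ P

/-- `fVec P i` is the number of `i`-dimensional (nonempty) faces of `P`. -/
def fVec {d : ℕ} (P : Set (Fin d → ℝ)) (i : ℕ) : ℕ :=
  {F : Set (Fin d → ℝ) | IsFaceOf P F ∧ F.Nonempty ∧ polyDim F = i}.ncard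

/-- A facet of a `d`-polytope in `ℝ^d`: a `(d-1)`-dimensional face. -/
def IsFacetOf {d : ℕ} (P F : Set (Fin d → ℝ)) : Prop :=
  IsFaceOf P F ∧ F.Nonempty ∧ polyDim F = d - 1

/-- `(P, F)` is an ASP-pair: `P` is a `d`-polytope, `F` is a facet of `P`, and every facet
of `P` other than `F` is a simplex (i.e. has exactly `d` vertices). -/
def IsASPPair {d : ℕ} (P F : Set (Fin d → ℝ)) : Prop :=
  IsPolytope P ∧ polyDim P = d ∧ IsFacetOf P F ∧
    ∀ G, IsFacetOf P G → G ≠ F → (verts G).ncard = d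

/-- `P ∈ 𝒫(d,n,s)`: `P` is a `d`-polytope with `n` vertices such that `(P,F)` is an
ASP-pair where the facet `F` has `d + s` vertices. -/
def MemASP (d n s : ℕ) (P : Set (Fin d → ℝ)) : Prop :=
  (verts P).ncard = n ∧ ∃ F, IsASPPair P F ∧ (verts F).ncard = d + s

/-- `fBall P i` is `f_{i-1}(P')` of the simplicial ball `P' = ∂P - {F}` consisting of all
proper faces of `P` except its (unique non-simplex) facet `F`; the index is shifted by one,
so `fBall P 0 = f_{-1} = 1` counts the empty face, and at the top dimension the facet `F`
is discarded. -/
def fBall {d : ℕ} (P : Set (Fin d → ℝ)) (i : ℕ) : ℤ :=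
  if i = 0 then 1
  else if i = d then (fVec P (d - 1) : ℤ) - 1
  else if d < i then 0
  else (fVec P (i - 1) : ℤ)

/-- `hBall P k` is `h_k(P')` of the `(d-1)`-dimensional ball `P' = ∂P - {F}`, defined by
`h_k = ∑_{i=0}^{k} (-1)^{k-i} C(d-i, k-i) f_{i-1}(P')`, extended by `0` outside `0 ≤ k ≤ d`. -/
def hBall {d : ℕ} (P : Set (Fin d → ℝ)) (k : ℤ) : ℤ :=
  if 0 ≤ k ∧ k ≤ (d : ℤ) then
    ∑ i ∈ Finset.range (k.toNat + 1),
      (-1) ^ (k.toNat - i) * ((d - i).choose (k.toNat - i) : ℤ) * fBall P i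
  else 0

/-- `fBd m Q i` is `f_{i-1}(∂Q)` of the boundary complex of an `m`-polytope `Q ⊆ ℝ^d`
(a complex of dimension `m - 1`); the index is shifted by one. -/
def fBd {d : ℕ} (m : ℕ) (Q : Set (Fin d → ℝ)) (i : ℕ) : ℤ :=
  if i = 0 then 1 else if m + 1 ≤ i then 0 else (fVec Q (i - 1) : ℤ)

/-- `hBd m Q k` is `h_k(∂Q)` for the boundary complex of an `m`-polytope `Q ⊆ ℝ^d`, defined by
`h_k = ∑_{i=0}^{k} (-1)^{k-i} C(m-i, k-i) f_{i-1}(∂Q)`, extended by `0` outside `0 ≤ k ≤ m`. -/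
def hBd {d : ℕ} (m : ℕ) (Q : Set (Fin d → ℝ)) (k : ℤ) : ℤ :=
  if 0 ≤ k ∧ k ≤ (m : ℤ) then
    ∑ i ∈ Finset.range (k.toNat + 1),
      (-1) ^ (k.toNat - i) * ((m - i).choose (k.toNat - i) : ℤ) * fBd m Q i
  else 0

/-- `gBd m Q k = g_k(∂Q) = h_k(∂Q) - h_{k-1}(∂Q)`. -/
def gBd {d : ℕ} (m : ℕ) (Q : Set (Fin d → ℝ)) (k : ℤ) : ℤ :=
  hBd m Q k - hBd m Q (k - 1)

/-- The function `p(t) = (n-1)^{(t-1)(d-1)} · t(t+1)⋯(t+d+s-1)` (real exponentiation of the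
positive base `n-1`) used to define the almost cyclic polytope. -/
def acp (d n s : ℕ) (t : ℝ) : ℝ :=
  ((n : ℝ) - 1) ^ ((t - 1) * ((d : ℝ) - 1)) * ∏ l ∈ Finset.range (d + s), (t + l)

/-- The curve `y(t) = (t, t², …, t^{d-1}, p(t)) ∈ ℝ^d`. -/
def acy (d n s : ℕ) (t : ℝ) : Fin d → ℝ :=
  fun i => if (i : ℕ) + 1 = d then acp d n s t else t ^ ((i : ℕ) + 1)

/-- The parameter values `t_i = -s - d + i` for `i = 1, …, n` (here `0`-indexed:
`acT d s j = t_{j+1}`). -/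
def acT (d s j : ℕ) : ℝ := (j : ℝ) + 1 - s - d

/-- The `n` points `y(t_1), …, y(t_n)` on the curve `y` (`0`-indexed). -/
def acPoint (d n s : ℕ) (j : Fin n) : Fin d → ℝ := acy d n s (acT d s (j : ℕ))

/-- The almost cyclic polytope `C(d,n,s) = conv{y(t_1), …, y(t_n)}`. -/
def acPolytope (d n s : ℕ) : Set (Fin d → ℝ) :=
  convexHull ℝ (Set.range (acPoint d n s))

/-- The non-simplex facet `F = conv{y(t_1), …, y(t_{d+s})}` of the almost cyclic polytope. -/
def acFacet (d n s : ℕ) : Set (Fin d → ℝ) :=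
  convexHull ℝ (acPoint d n s '' {j : Fin n | (j : ℕ) < d + s})

/-- The generalized moment curve
`x(t) = (t, t², …, t^{d-r}, p_1(t), …, p_r(t)) ∈ ℝ^d`. -/
def gmc (d r : ℕ) (p : Fin r → ℝ → ℝ) (t : ℝ) : Fin d → ℝ :=
  fun i =>
    if h : (i : ℕ) < d - r then t ^ ((i : ℕ) + 1)
    else p ⟨(i : ℕ) - (d - r), by have h2 := i.2; omega⟩ t

/-- A polytope is `k`-neighborly if each subset of at most `k` of its vertices is the
vertex set of a face. -/
def IsNeighborly {d : ℕ} (k : ℕ) (P : Set (Fin d → ℝ)) : Prop :=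
  ∀ S : Finset (Fin d → ℝ), (S : Set (Fin d → ℝ)) ⊆ verts P → S.card ≤ k →
    ∃ G : Set (Fin d → ℝ), IsFaceOf P G ∧ verts G = (S : Set (Fin d → ℝ))

/-- The point `y` is beyond the facet `F` of the polytope `P`: for every supporting
hyperplane of `P` cutting out a facet, `y` is strictly on the outer side if the facet is `F`,
and strictly on the inner side otherwise. -/
def IsBeyond {d : ℕ} (P F : Set (Fin d → ℝ)) (y : Fin d → ℝ) : Prop :=
  ∀ (b : Fin d → ℝ) (c : ℝ), b ≠ 0 → (∀ x ∈ P, dotp b x ≤ c) →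
    IsFacetOf P {x ∈ P | dotp b x = c} →
      (({x ∈ P | dotp b x = c} = F → c < dotp b y) ∧
       ({x ∈ P | dotp b x = c} ≠ F → dotp b y < c))

theorem alt_insert {n : ℕ} (a : Fin n → ℝ) (V : Finset (Fin n)) (m : Fin n)
    (hm : ∀ x ∈ V, x < m) :
    ∑ j ∈ insert m V, (-1 : ℝ) ^ ((insert m V).filter (fun k => j < k)).card * a j
      = a m - ∑ j ∈ V, (-1 : ℝ) ^ (V.filter (fun k => j < k)).card * a j := by
  have hmV : m ∉ V := fun h => lt_irrefl _ (hm m h)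
  rw [Finset.sum_insert hmV]
  have h1 : (insert m V).filter (fun k => m < k) = ∅ := by
    ext x
    simp only [Finset.mem_filter, Finset.mem_insert, Finset.notMem_empty, iff_false, not_and]
    rintro (rfl | h)
    · exact lt_irrefl _
    · exact not_lt.2 (hm x h).le
  rw [h1]
  have h2 : ∀ j ∈ V, (-1 : ℝ) ^ ((insert m V).filter (fun k => j < k)).card * a j
      = - ((-1 : ℝ) ^ (V.filter (fun k => j < k)).card * a j) := by
    intro j hj
    rw [Finset.filter_insert, if_pos (hm j hj), Finset.card_insert_of_notMem (by simp [hmV])]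
    ring
  rw [Finset.sum_congr rfl h2, Finset.sum_neg_distrib]
  simp; ring

theorem alt_bounds {n : ℕ} (a : Fin n → ℝ) (U : Finset (Fin n)) :
    (∀ j ∈ U, 0 ≤ a j) → (∀ j ∈ U, ∀ k ∈ U, j < k → a j ≤ a k) →
    0 ≤ ∑ j ∈ U, (-1 : ℝ) ^ (U.filter (fun k => j < k)).card * a j ∧
    (∀ M, 0 ≤ M → (∀ j ∈ U, a j ≤ M) →
      ∑ j ∈ U, (-1 : ℝ) ^ (U.filter (fun k => j < k)).card * a j ≤ M) ∧
    (∀ M, 0 < M → (∀ j ∈ U, a j < M) →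
      ∑ j ∈ U, (-1 : ℝ) ^ (U.filter (fun k => j < k)).card * a j < M) := by
  induction U using Finset.induction_on_max with
  | empty => intro _ _; simp
  | insert m V hm ih =>
    intro h0 hmono
    obtain ⟨i1, i2, i3⟩ := ih (fun j hj => h0 j (by simp [hj]))
      (fun j hj k hk => hmono j (by simp [hj]) k (by simp [hk]))
    rw [alt_insert a V m hm]
    have hm0 := h0 m (by simp)
    have := i2 (a m) hm0 (fun j hj => hmono j (by simp [hj]) m (by simp) (hm j hj))
    refine ⟨by linarith, fun M _ hM => ?_, fun M _ hM => ?_⟩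
    · have := hM m (by simp); linarith
    · have := hM m (by simp); linarith

theorem alt_pos {n : ℕ} (a : Fin n → ℝ) (U : Finset (Fin n)) (m : Fin n) (hmU : m ∈ U)
    (hmax : ∀ j ∈ U, j ≤ m)
    (h0 : ∀ j ∈ U, 0 ≤ a j) (hm0 : 0 < a m)
    (hmono : ∀ j ∈ U, ∀ k ∈ U, j < k → a j ≤ a k)
    (hs : ∀ j ∈ U, j < m → a j < a m) :
    0 < ∑ j ∈ U, (-1 : ℝ) ^ (U.filter (fun k => j < k)).card * a j := by
  have hlt : ∀ x ∈ U.erase m, x < m := fun x hx =>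
    lt_of_le_of_ne (hmax x (Finset.mem_of_mem_erase hx)) (Finset.ne_of_mem_erase hx)
  have key := alt_insert a (U.erase m) m hlt
  rw [Finset.insert_erase hmU] at key
  rw [key]
  have := (alt_bounds a (U.erase m) (fun j hj => h0 j (Finset.mem_of_mem_erase hj))
    (fun j hj k hk => hmono j (Finset.mem_of_mem_erase hj) k (Finset.mem_of_mem_erase hk))).2.2
    (a m) hm0 (fun j hj => hs j (Finset.mem_of_mem_erase hj) (hlt j hj))
  linarith

theorem acT_lt (d s : ℕ) {i j : ℕ} : acT d s i < acT d s j ↔ i < j := by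
  simp [acT]

theorem acT_inj (d s n : ℕ) : Function.Injective (fun j : Fin n => acT d s (j : ℕ)) := by
  intro i j h
  simp [acT] at h
  exact Fin.ext h

theorem acp_zero (d n s j : ℕ) (hj : j < d + s) : acp d n s (acT d s j) = 0 := by
  unfold acp
  apply mul_eq_zero_of_right
  refine Finset.prod_eq_zero (i := d + s - 1 - j) (by simp; omega) ?_
  have : ((d + s - 1 - j : ℕ) : ℝ) = d + s - 1 - j := by
    rw [Nat.sub_sub, Nat.cast_sub (by omega)]; push_cast; ring
  rw [this, acT]; ring

theorem acT_one_le (d s j : ℕ) (hj : d + s ≤ j) : 1 ≤ acT d s j := by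
  have : (d : ℝ) + s ≤ j := by exact_mod_cast hj
  unfold acT; linarith

theorem acp_pos (d n s j : ℕ) (hn : 2 < n) (hj : d + s ≤ j) : 0 < acp d n s (acT d s j) := by
  have h1 := acT_one_le d s j hj
  have h2 : (2 : ℝ) < n := by exact_mod_cast hn
  unfold acp
  refine mul_pos (Real.rpow_pos_of_pos (by linarith) _) (Finset.prod_pos fun l _ => ?_)
  positivity

theorem acp_nonneg (d n s j : ℕ) (hn : 2 < n) : 0 ≤ acp d n s (acT d s j) := by
  rcases lt_or_ge j (d + s) with h | h
  · exact (acp_zero d n s j h).ge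
  · exact (acp_pos d n s j hn h).le

theorem acp_growth (d n s j k : ℕ) (hd : 2 ≤ d) (hn : 2 < n) (hjk : j < k) (hk : d + s ≤ k) :
    ((n : ℝ) - 1) ^ (d - 1) * acp d n s (acT d s j) < acp d n s (acT d s k) := by
  rcases lt_or_ge j (d + s) with h | h
  · rw [acp_zero d n s j h, mul_zero]; exact acp_pos d n s k hn hk
  · have h1 := acT_one_le d s j h
    have h2 : (2 : ℝ) < n := by exact_mod_cast hn
    have h3 : acT d s j + 1 ≤ acT d s k := by
      have : (j : ℝ) + 1 ≤ k := by exact_mod_cast hjk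
      unfold acT; linarith
    have hd' : (2 : ℝ) ≤ d := by exact_mod_cast hd
    unfold acp
    rw [← mul_assoc]
    have e1 : ((n : ℝ) - 1) ^ (d - 1) * ((n : ℝ) - 1) ^ ((acT d s j - 1) * ((d : ℝ) - 1))
        ≤ ((n : ℝ) - 1) ^ ((acT d s k - 1) * ((d : ℝ) - 1)) := by
      rw [← Real.rpow_natCast, ← Real.rpow_add (by linarith)]
      apply Real.rpow_le_rpow_of_exponent_le (by linarith)
      rw [Nat.cast_sub (by omega)]
      push_cast
      nlinarith
    have e2 : ∏ l ∈ Finset.range (d + s), (acT d s j + l)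
        < ∏ l ∈ Finset.range (d + s), (acT d s k + l) := by
      apply Finset.prod_lt_prod_of_nonempty
      · intro l _; positivity
      · intro l _; linarith
      · simp; omega
    have e3 : 0 < ∏ l ∈ Finset.range (d + s), (acT d s j + l) :=
      Finset.prod_pos fun l _ => by positivity
    have e4 : 0 < ((n : ℝ) - 1) ^ ((acT d s k - 1) * ((d : ℝ) - 1)) :=
      Real.rpow_pos_of_pos (by linarith) _
    calc _ ≤ ((n : ℝ) - 1) ^ ((acT d s k - 1) * ((d : ℝ) - 1))
            * ∏ l ∈ Finset.range (d + s), (acT d s j + l) :=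
          mul_le_mul_of_nonneg_right e1 e3.le
      _ < _ := mul_lt_mul_of_pos_left e2 e4

/-- sign of the product -/
theorem prod_sign (d s n : ℕ) (U : Finset (Fin n)) (j : Fin n) (hj : j ∉ U) :
    ∏ k ∈ U, (acT d s (j : ℕ) - acT d s (k : ℕ)) =
      (-1) ^ (U.filter (fun k => j < k)).card *
        ∏ k ∈ U, |acT d s (j : ℕ) - acT d s (k : ℕ)| := by
  rw [Finset.card_filter, ← Finset.prod_pow_eq_pow_sum, ← Finset.prod_mul_distrib]
  refine Finset.prod_congr rfl fun k hk => ?_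
  by_cases h : j < k
  · have : acT d s (j : ℕ) < acT d s (k : ℕ) := (acT_lt d s).2 h
    rw [if_pos h, abs_of_neg (by linarith)]; ring
  · have : acT d s (k : ℕ) < acT d s (j : ℕ) := (acT_lt d s).2
      (lt_of_le_of_ne (not_lt.1 h) (fun e => hj (Fin.ext e ▸ hk)))
    rw [if_neg h, abs_of_pos (by linarith)]; ring

theorem abs_acT_le (d s n : ℕ) (j k : Fin n) :
    |acT d s (j : ℕ) - acT d s (k : ℕ)| ≤ (n : ℝ) - 1 := by
  have h1 : ((j : ℕ) : ℝ) + 1 ≤ n := by exact_mod_cast j.2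
  have h2 : ((k : ℕ) : ℝ) + 1 ≤ n := by exact_mod_cast k.2
  have h3 : (0 : ℝ) ≤ ((j : ℕ) : ℝ) := by positivity
  have h4 : (0 : ℝ) ≤ ((k : ℕ) : ℝ) := by positivity
  rw [abs_le]; unfold acT; constructor <;> linarith

theorem one_le_abs_acT (d s n : ℕ) (j k : Fin n) (h : j ≠ k) :
    1 ≤ |acT d s (j : ℕ) - acT d s (k : ℕ)| := by
  have : acT d s (j : ℕ) - acT d s (k : ℕ) = (((j : ℕ) : ℤ) - ((k : ℕ) : ℤ) : ℤ) := by
    unfold acT; push_cast; ring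
  rw [this, ← Int.cast_abs]
  have : (1 : ℤ) ≤ |((j : ℕ) : ℤ) - ((k : ℕ) : ℤ)| := by
    apply Int.one_le_abs
    intro h'
    exact h (Fin.ext (by omega))
  exact_mod_cast this

theorem frac_lt {p q δ a b N : ℝ} (hδ : 0 < δ) (ha : 1 ≤ a) (hb : 0 < b) (hbN : b ≤ N)
    (hp : 0 ≤ p) (h : N * p < q) : p / (δ * a) < q / (δ * b) := by
  have hq : 0 < q := lt_of_le_of_lt (mul_nonneg (hb.le.trans hbN) hp) h
  rw [div_lt_div_iff₀ (by positivity) (by positivity)]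
  have h1 : p * b < q * a := by
    have : p * b ≤ N * p := by nlinarith
    have : q ≤ q * a := le_mul_of_one_le_right hq.le ha
    linarith
  nlinarith

theorem weight_lt (d n s : ℕ) (hd : 2 ≤ d) (hn : 2 < n) (U : Finset (Fin n))
    (hU : U.card = d + 1) (j k : Fin n) (hj : j ∈ U) (hk : k ∈ U) (hjk : j < k)
    (hks : d + s ≤ (k : ℕ)) :
    acp d n s (acT d s j) / ∏ l ∈ U.erase j, |acT d s (j : ℕ) - acT d s (l : ℕ)| <
    acp d n s (acT d s k) / ∏ l ∈ U.erase k, |acT d s (k : ℕ) - acT d s (l : ℕ)| := by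
  have hne : j ≠ k := hjk.ne
  set W := (U.erase j).erase k with hW
  have hW' : W = (U.erase k).erase j := by rw [hW, Finset.erase_right_comm]
  have hWc : W.card = d - 1 := by
    rw [hW, Finset.card_erase_of_mem (by simp [hk, hne.symm]), Finset.card_erase_of_mem hj]; omega
  rw [← Finset.mul_prod_erase (U.erase j) _ (show k ∈ U.erase j by simp [hk, hne.symm]),
    ← Finset.mul_prod_erase (U.erase k) _ (show j ∈ U.erase k by simp [hj, hne]),
    ← hW, ← hW', abs_sub_comm (acT d s (k : ℕ)) (acT d s (j : ℕ))]
  set δ := |acT d s (j : ℕ) - acT d s (k : ℕ)|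
  have hδ : 0 < δ := by have := one_le_abs_acT d s n j k hne; linarith
  have h2 : (2 : ℝ) < n := by exact_mod_cast hn
  have A : 1 ≤ ∏ l ∈ W, |acT d s (j : ℕ) - acT d s (l : ℕ)| := by
    have : ∏ l ∈ W, (1 : ℝ) ≤ ∏ l ∈ W, |acT d s (j : ℕ) - acT d s (l : ℕ)| :=
      Finset.prod_le_prod (fun _ _ => zero_le_one) fun l hl =>
        one_le_abs_acT d s n j l (by rintro rfl; simp [hW] at hl)
    simpa using this
  have B : ∏ l ∈ W, |acT d s (k : ℕ) - acT d s (l : ℕ)| ≤ ((n : ℝ) - 1) ^ (d - 1) := by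
    rw [← hWc, ← Finset.prod_const]
    exact Finset.prod_le_prod (fun _ _ => abs_nonneg _) fun l _ => abs_acT_le d s n k l
  have B0 : 0 < ∏ l ∈ W, |acT d s (k : ℕ) - acT d s (l : ℕ)| :=
    Finset.prod_pos fun l hl => by
      have := one_le_abs_acT d s n k l (by rintro rfl; simp [hW] at hl)
      linarith
  have G := acp_growth d n s j k hd hn hjk hks
  have P0 := acp_nonneg d n s j hn
  exact frac_lt hδ A B0 B P0 G

theorem divdiff_pos (d n s : ℕ) (hd : 2 ≤ d) (hn : 2 < n) (U : Finset (Fin n))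
    (hU : U.card = d + 1) (hI : ∃ j ∈ U, d + s ≤ (j : ℕ)) :
    0 < ∑ j ∈ U, acp d n s (acT d s j) /
      ∏ l ∈ U.erase j, (acT d s (j : ℕ) - acT d s (l : ℕ)) := by
  obtain ⟨i, hiU, his⟩ := hI
  have hne : U.Nonempty := ⟨i, hiU⟩
  set m := U.max' hne with hm
  have hmU : m ∈ U := U.max'_mem hne
  have hmax : ∀ j ∈ U, j ≤ m := fun j hj => U.le_max' j hj
  have hms : d + s ≤ (m : ℕ) := le_trans his (hmax i hiU)
  have hpos : ∀ j ∈ U, 0 < ∏ l ∈ U.erase j, |acT d s (j : ℕ) - acT d s (l : ℕ)| := by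
    intro j _
    refine Finset.prod_pos fun l hl => ?_
    have := one_le_abs_acT d s n j l (Finset.ne_of_mem_erase hl).symm
    linarith
  have h0 : ∀ j ∈ U, 0 ≤ acp d n s (acT d s j) /
      ∏ l ∈ U.erase j, |acT d s (j : ℕ) - acT d s (l : ℕ)| := fun j hj =>
    div_nonneg (acp_nonneg d n s j hn) (hpos j hj).le
  have key := alt_pos (fun j : Fin n => acp d n s (acT d s j) /
      ∏ l ∈ U.erase j, |acT d s (j : ℕ) - acT d s (l : ℕ)|) U m hmU hmax h0
    (div_pos (acp_pos d n s m hn hms) (hpos m hmU))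
    (by
      intro j hj k hk hjk
      rcases lt_or_ge (k : ℕ) (d + s) with h | h
      · have : (j : ℕ) < d + s := lt_trans hjk h
        rw [acp_zero d n s j this, zero_div]
        exact h0 k hk
      · exact (weight_lt d n s hd hn U hU j k hj hk hjk h).le)
    (fun j hj hjm => weight_lt d n s hd hn U hU j m hj hmU hjm hms)
  refine key.trans_eq (Finset.sum_congr rfl fun j hj => ?_)
  rw [prod_sign d s n (U.erase j) j (by simp)]
  have : (U.erase j).filter (fun k => j < k) = U.filter (fun k => j < k) := by
    ext x; simp only [Finset.mem_filter, Finset.mem_erase]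
    exact ⟨fun h => ⟨h.1.2, h.2⟩, fun h => ⟨⟨h.2.ne', h.1⟩, h.2⟩⟩
  rw [this]
  rcases neg_one_pow_eq_or ℝ (U.filter (fun k => j < k)).card with h | h <;> rw [h]
  · simp
  · rw [neg_one_mul, neg_one_mul, div_neg]

theorem key_formula (d n s : ℕ) (hd : 2 ≤ d) (hn : d + s < n)
    (S : Finset (Fin n)) (hcard : S.card = d)
    (hnotI : ¬ ∀ j ∈ S, (j : ℕ) < d + s) (u : Fin n) (hu : u ∉ S) :
    ∃ D : ℝ, 0 < D ∧ ∀ (Q : Polynomial ℝ) (e : ℝ), Q.degree < (d : ℕ) →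
      (∀ j ∈ S, Q.eval (acT d s (j : ℕ)) + e * acp d n s (acT d s (j : ℕ)) = 0) →
      Q.eval (acT d s (u : ℕ)) + e * acp d n s (acT d s (u : ℕ)) =
        e * D * ∏ k ∈ S, (acT d s (u : ℕ) - acT d s (k : ℕ)) := by
  have hUc : (insert u S).card = d + 1 := by rw [Finset.card_insert_of_notMem hu, hcard]
  refine ⟨_, divdiff_pos d n s hd (by omega) (insert u S) hUc ?_, ?_⟩
  · push Not at hnotI
    obtain ⟨j, hj, h⟩ := hnotI
    exact ⟨j, by simp [hj], h⟩
  · intro Q e hQ hS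
    have h1 := Lagrange.coeff_eq_sum (s := insert u S) (v := fun j : Fin n => acT d s (j : ℕ))
      ((acT_inj d s n).injOn) (P := Q)
      (hQ.trans (by rw [hUc]; exact_mod_cast Nat.lt_succ_self d))
    rw [hUc, Nat.add_sub_cancel, Polynomial.coeff_eq_zero_of_degree_lt hQ] at h1
    have h2 : e * ∑ j ∈ insert u S, acp d n s (acT d s j) /
        ∏ l ∈ (insert u S).erase j, (acT d s (j : ℕ) - acT d s (l : ℕ)) =
        ∑ j ∈ insert u S, (Q.eval (acT d s (j : ℕ)) + e * acp d n s (acT d s (j : ℕ))) /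
        ∏ l ∈ (insert u S).erase j, (acT d s (j : ℕ) - acT d s (l : ℕ)) := by
      simp only [add_div]
      rw [Finset.sum_add_distrib, ← h1, zero_add, Finset.mul_sum]
      exact Finset.sum_congr rfl fun j _ => by ring
    rw [h2, Finset.sum_insert hu, Finset.sum_eq_zero (s := S)
      (fun j hj => by rw [hS j hj, zero_div]), add_zero, Finset.erase_insert hu]
    have h3 : ∏ k ∈ S, (acT d s (u : ℕ) - acT d s (k : ℕ)) ≠ 0 := by
      refine Finset.prod_ne_zero_iff.2 fun k hk h => ?_
      have : u = k := acT_inj d s n (sub_eq_zero.1 h)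
      exact hu (this ▸ hk)
    rw [div_mul_cancel₀ _ h3]

theorem dotp_acy (m n s : ℕ) (b : Fin (m + 1) → ℝ) (t : ℝ) :
    dotp b (acy (m + 1) n s t) =
      ∑ i : Fin m, b i.castSucc * t ^ ((i : ℕ) + 1) + b (Fin.last m) * acp (m + 1) n s t := by
  unfold dotp
  rw [Fin.sum_univ_castSucc]
  congr 1
  · refine Finset.sum_congr rfl fun i _ => ?_
    have : ¬ ((i : ℕ) + 1 = m + 1) := by have := i.2; omega
    simp [acy, this, -add_left_inj]
    intro h; omega
  · simp [acy]

theorem poly_of_hyper (m n s : ℕ) (b : Fin (m + 1) → ℝ) (c : ℝ) :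
    ∃ Q : Polynomial ℝ, Q.degree < (m + 1 : ℕ) ∧
      (∀ t, dotp b (acy (m + 1) n s t) - c =
        Q.eval t + b (Fin.last m) * acp (m + 1) n s t) ∧
      (b (Fin.last m) = 0 → Q = 0 → b = 0) := by
  refine ⟨∑ i : Fin m, Polynomial.monomial ((i : ℕ) + 1) (b i.castSucc) - Polynomial.C c,
    ?_, ?_, ?_⟩
  · refine lt_of_le_of_lt (Polynomial.degree_sub_le _ _) (max_lt ?_ ?_)
    · refine lt_of_le_of_lt (Polynomial.degree_sum_le _ _) ?_
      rw [Finset.sup_lt_iff (WithBot.bot_lt_coe _)]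
      intro i _
      refine lt_of_le_of_lt (Polynomial.degree_monomial_le _ _) ?_
      exact_mod_cast Nat.succ_lt_succ i.2
    · refine lt_of_le_of_lt Polynomial.degree_C_le ?_
      exact_mod_cast Nat.succ_pos m
  · intro t
    rw [dotp_acy]
    simp [Polynomial.eval_finsetSum]
    ring
  · intro h0 hQ
    funext i
    refine Fin.lastCases h0 (fun i => ?_) i
    have := congrArg (fun q => Polynomial.coeff q ((i : ℕ) + 1)) hQ
    simp [Polynomial.finsetSum_coeff, Polynomial.coeff_monomial, Polynomial.coeff_C,
      Fin.val_inj] at this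
    simpa using this

theorem hyper_of_poly (m n s : ℕ) (Q : Polynomial ℝ) (hQ : Q.degree < (m + 1 : ℕ)) (e : ℝ) :
    ∃ (b : Fin (m + 1) → ℝ) (c : ℝ), b (Fin.last m) = e ∧
      (∀ t, dotp b (acy (m + 1) n s t) - c = Q.eval t + e * acp (m + 1) n s t) := by
  refine ⟨Fin.snoc (fun i : Fin m => Q.coeff ((i : ℕ) + 1)) e, - Q.coeff 0, by simp, ?_⟩
  intro t
  rw [dotp_acy]
  have hnd : Q.natDegree < m + 1 := by
    by_cases h : Q = 0
    · simp [h]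
    · exact (Polynomial.natDegree_lt_iff_degree_lt h).2 hQ
  rw [Polynomial.eval_eq_sum_range' hnd, Finset.sum_range_succ', Finset.sum_range]
  simp
  ring

theorem even_iff (d s n : ℕ) (S : Finset (Fin n)) (u v : Fin n) (huv : u ≤ v)
    (hu : u ∉ S) (hv : v ∉ S) :
    Even ((S.filter fun j : Fin n =>
          acT d s (u : ℕ) < acT d s (j : ℕ) ∧ acT d s (j : ℕ) < acT d s (v : ℕ)).card) ↔
    0 < (∏ k ∈ S, (acT d s (u : ℕ) - acT d s (k : ℕ))) *
      ∏ k ∈ S, (acT d s (v : ℕ) - acT d s (k : ℕ)) := by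
  have hP : (∏ k ∈ S, (acT d s (u : ℕ) - acT d s (k : ℕ))) *
      ∏ k ∈ S, (acT d s (v : ℕ) - acT d s (k : ℕ)) =
      (-1) ^ (S.filter fun j : Fin n =>
          acT d s (u : ℕ) < acT d s (j : ℕ) ∧ acT d s (j : ℕ) < acT d s (v : ℕ)).card *
      ∏ k ∈ S, |(acT d s (u : ℕ) - acT d s (k : ℕ)) * (acT d s (v : ℕ) - acT d s (k : ℕ))| := by
    rw [Finset.card_filter, ← Finset.prod_pow_eq_pow_sum, ← Finset.prod_mul_distrib,
      ← Finset.prod_mul_distrib]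
    refine Finset.prod_congr rfl fun k hk => ?_
    have huv' : acT d s (u : ℕ) ≤ acT d s (v : ℕ) := by
      have : ((u : ℕ) : ℝ) ≤ ((v : ℕ) : ℝ) := by exact_mod_cast huv
      unfold acT; linarith
    split_ifs with h
    · rw [abs_of_neg (mul_neg_of_neg_of_pos (by linarith [h.1]) (by linarith [h.2]))]; ring
    · rw [abs_of_nonneg]
      · ring
      · by_cases h1 : acT d s (u : ℕ) < acT d s (k : ℕ)
        · have h2 : acT d s (v : ℕ) ≤ acT d s (k : ℕ) := not_lt.1 fun h2 => h ⟨h1, h2⟩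
          exact mul_nonneg_of_nonpos_of_nonpos (by linarith) (by linarith)
        · exact mul_nonneg (by linarith) (by linarith)
  have hpos : 0 < ∏ k ∈ S,
      |(acT d s (u : ℕ) - acT d s (k : ℕ)) * (acT d s (v : ℕ) - acT d s (k : ℕ))| := by
    refine Finset.prod_pos fun k hk => abs_pos.2 (mul_ne_zero ?_ ?_)
    · intro h
      exact hu ((acT_inj d s n (sub_eq_zero.1 h) : u = k) ▸ hk)
    · intro h
      exact hv ((acT_inj d s n (sub_eq_zero.1 h) : v = k) ▸ hk)
  rw [hP]
  constructor
  · intro h; rw [h.neg_one_pow, one_mul]; exact hpos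
  · intro h
    by_contra h'
    rw [Nat.not_even_iff_odd] at h'
    rw [h'.neg_one_pow] at h
    linarith

theorem dotp_sum {d : ℕ} {ι : Type*} (T : Finset ι) (b : Fin d → ℝ) (w : ι → ℝ)
    (z : ι → Fin d → ℝ) :
    dotp b (∑ i ∈ T, w i • z i) = ∑ i ∈ T, w i * dotp b (z i) := by
  unfold dotp
  simp only [Finset.sum_apply, Pi.smul_apply, smul_eq_mul, Finset.mul_sum]
  rw [Finset.sum_comm]
  exact Finset.sum_congr rfl fun i _ => Finset.sum_congr rfl fun j _ => by ring

theorem mem_hull_range {d n : ℕ} (y : Fin n → Fin d → ℝ) (T : Finset (Fin n)) (x : Fin d → ℝ)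
    (hx : x ∈ convexHull ℝ (y '' (T : Set (Fin n)))) :
    ∃ w : Fin n → ℝ, (∀ i, 0 ≤ w i) ∧ ∑ i ∈ T, w i = 1 ∧ x = ∑ i ∈ T, w i • y i := by
  have : convexHull ℝ (y '' (T : Set (Fin n))) ⊆ {x | ∃ w : Fin n → ℝ, (∀ i, 0 ≤ w i) ∧
      ∑ i ∈ T, w i = 1 ∧ x = ∑ i ∈ T, w i • y i} := by
    apply convexHull_min
    · rintro _ ⟨i, hi, rfl⟩
      refine ⟨fun k => if k = i then 1 else 0, fun k => by dsimp only; split_ifs <;> norm_num, ?_, ?_⟩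
      · simpa using hi
      · have : i ∈ T := hi
        simp [this]
    · rintro _ ⟨w, hw, hw1, rfl⟩ _ ⟨w', hw', hw1', rfl⟩ a b ha hb hab
      refine ⟨fun k => a * w k + b * w' k, fun k => ?_, ?_, ?_⟩
      · have := hw k
        have := hw' k
        positivity
      · rw [Finset.sum_add_distrib, ← Finset.mul_sum, ← Finset.mul_sum, hw1, hw1']; linarith
      · simp only [Finset.smul_sum, add_smul, mul_smul, Finset.sum_add_distrib]
  exact this hx

theorem dotp_le_of_hull {d n : ℕ} (y : Fin n → Fin d → ℝ) (T : Finset (Fin n)) (x : Fin d → ℝ)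
    (b : Fin d → ℝ) (c : ℝ) (h : ∀ i ∈ T, dotp b (y i) ≤ c)
    (hx : x ∈ convexHull ℝ (y '' (T : Set (Fin n)))) : dotp b x ≤ c := by
  obtain ⟨w, hw, hw1, rfl⟩ := mem_hull_range y T x hx
  rw [dotp_sum]
  calc _ ≤ ∑ i ∈ T, w i * c := Finset.sum_le_sum fun i hi =>
        mul_le_mul_of_nonneg_left (h i hi) (hw i)
    _ = c := by rw [← Finset.sum_mul, hw1, one_mul]

theorem dotp_eq_of_hull {d n : ℕ} (y : Fin n → Fin d → ℝ) (T : Finset (Fin n)) (x : Fin d → ℝ)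
    (b : Fin d → ℝ) (c : ℝ) (h : ∀ i ∈ T, dotp b (y i) = c)
    (hx : x ∈ convexHull ℝ (y '' (T : Set (Fin n)))) : dotp b x = c := by
  obtain ⟨w, hw, hw1, rfl⟩ := mem_hull_range y T x hx
  rw [dotp_sum, Finset.sum_congr rfl (fun i hi => by rw [h i hi]), ← Finset.sum_mul, hw1, one_mul]

theorem face_eq {d n : ℕ} (y : Fin n → Fin d → ℝ) (S : Finset (Fin n))
    (b : Fin d → ℝ) (c : ℝ) (h : ∀ i ∈ S, dotp b (y i) = c) (h' : ∀ i ∉ S, dotp b (y i) < c) :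
    convexHull ℝ (y '' (S : Set (Fin n))) =
      {x ∈ convexHull ℝ (Set.range y) | dotp b x = c} := by
  ext x
  constructor
  · intro hx
    exact ⟨convexHull_mono (Set.image_subset_range _ _) hx, dotp_eq_of_hull y S x b c h hx⟩
  · rintro ⟨hx, hxc⟩
    rw [← Set.image_univ, ← Finset.coe_univ] at hx
    obtain ⟨w, hw, hw1, rfl⟩ := mem_hull_range y _ x hx
    rw [dotp_sum] at hxc
    have h0 : ∑ i, w i * (c - dotp b (y i)) = 0 := by
      simp only [mul_sub, Finset.sum_sub_distrib, ← Finset.sum_mul, hw1, hxc]; ring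
    have h1 : ∀ i ∈ Finset.univ, w i * (c - dotp b (y i)) = 0 := by
      refine (Finset.sum_eq_zero_iff_of_nonneg fun i _ => ?_).1 h0
      refine mul_nonneg (hw i) ?_
      by_cases hi : i ∈ S
      · linarith [h i hi]
      · linarith [h' i hi]
    have h2 : ∀ i, i ∉ S → w i = 0 := by
      intro i hi
      rcases mul_eq_zero.1 (h1 i (Finset.mem_univ _)) with h | h
      · exact h
      · linarith [h' i hi]
    have h3 : ∑ i ∈ S, w i = 1 := by
      rw [← hw1]
      exact Finset.sum_subset (Finset.subset_univ _) fun i _ hi => h2 i hi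
    have h4 : ∑ i ∈ S, w i • y i = ∑ i, w i • y i :=
      Finset.sum_subset (Finset.subset_univ _) fun i _ hi => by rw [h2 i hi, zero_smul]
    rw [← h4]
    exact (convex_convexHull ℝ _).sum_mem (fun i _ => hw i) h3
      fun i hi => subset_convexHull ℝ _ ⟨i, hi, rfl⟩

theorem dim_eq (m n s : ℕ) (S : Finset (Fin n)) (hcard : S.card = m + 1) :
    polyDim (convexHull ℝ (acPoint (m + 1) n s '' (S : Set (Fin n)))) = m := by
  unfold polyDim
  rw [affineSpan_convexHull, direction_affineSpan]
  have hr : acPoint (m + 1) n s '' (S : Set (Fin n)) =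
      Set.range (fun j : S => acPoint (m + 1) n s j) := by
    ext x; simp
  rw [hr]
  refine AffineIndependent.finrank_vectorSpan ?_ (by simp [hcard])
  rw [affineIndependent_iff_of_fintype]
  intro w hw hw' i
  rw [Finset.weightedVSub_eq_linear_combination _ hw] at hw'
  have hinj := ((acT_inj (m + 1) s n).injOn (s := (S : Set (Fin n))))
  obtain ⟨b, c, -, hb⟩ := hyper_of_poly m n s
    (Lagrange.basis S (fun j : Fin n => acT (m + 1) s (j : ℕ)) i) (by
      rw [Lagrange.degree_basis hinj i.2, hcard]
      exact_mod_cast Nat.lt_succ_self m) 0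
  have h1 := congrArg (dotp b) hw'
  rw [dotp_sum] at h1
  have h2 : dotp b (0 : Fin (m + 1) → ℝ) = 0 := by simp [dotp]
  rw [h2] at h1
  have h3 : ∑ j : S, w j * (dotp b (acPoint (m + 1) n s j) - c) = 0 := by
    simp only [mul_sub, Finset.sum_sub_distrib, ← Finset.sum_mul, hw, h1]; ring
  rw [Finset.sum_eq_single i] at h3
  · unfold acPoint at h3
    rw [hb, Lagrange.eval_basis_self (v := fun j : Fin n => acT (m + 1) s (j : ℕ)) hinj i.2] at h3
    simpa using h3
  · intro j _ hj
    unfold acPoint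
    rw [hb, Lagrange.eval_basis_of_ne (v := fun j : Fin n => acT (m + 1) s (j : ℕ))
      (fun h => hj (Subtype.ext h.symm)) j.2]
    simp
  · simp

theorem exists_hyper (m n s : ℕ) (hd : 2 ≤ m + 1) (hn : m + 1 + s < n)
    (S : Finset (Fin n)) (hcard : S.card = m + 1)
    (hnotI : ¬ ∀ j ∈ S, (j : ℕ) < m + 1 + s) (e : ℝ) :
    ∃ (b : Fin (m + 1) → ℝ) (c : ℝ), b (Fin.last m) = e ∧
      (∀ j ∈ S, dotp b (acPoint (m + 1) n s j) = c) ∧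
      ∀ u ∉ S, ∃ D > 0, dotp b (acPoint (m + 1) n s u) - c =
        e * D * ∏ k ∈ S, (acT (m + 1) s (u : ℕ) - acT (m + 1) s (k : ℕ)) := by
  have hinj := ((acT_inj (m + 1) s n).injOn (s := (S : Set (Fin n))))
  set Q := Lagrange.interpolate S (fun j : Fin n => acT (m + 1) s (j : ℕ))
    (fun j : Fin n => -e * acp (m + 1) n s (acT (m + 1) s (j : ℕ))) with hQ
  have hdeg : Q.degree < (m + 1 : ℕ) := hcard ▸ Lagrange.degree_interpolate_lt _ hinj
  have hev : ∀ j ∈ S, Q.eval (acT (m + 1) s (j : ℕ)) +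
      e * acp (m + 1) n s (acT (m + 1) s (j : ℕ)) = 0 := by
    intro j hj
    have := Lagrange.eval_interpolate_at_node
      (fun j : Fin n => -e * acp (m + 1) n s (acT (m + 1) s (j : ℕ))) hinj hj
    rw [← hQ] at this
    rw [this]; ring
  obtain ⟨b, c, hbe, hb⟩ := hyper_of_poly m n s Q hdeg e
  refine ⟨b, c, hbe, fun j hj => ?_, fun u hu => ?_⟩
  · have := hb (acT (m + 1) s (j : ℕ))
    rw [hev j hj] at this
    unfold acPoint; linarith
  · obtain ⟨D, hD, h⟩ := key_formula (m + 1) n s hd hn S hcard hnotI u hu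
    exact ⟨D, hD, by unfold acPoint; rw [hb, h Q e hdeg hev]⟩

/-- **Gale's evenness condition for the almost cyclic polytope.** Let `d ≥ 2`, `s ≥ 0`,
`n > d+s`, and let `S` be a `d`-element subset of `T = {t_1, …, t_n}` not contained in
`I = {t_1, …, t_{d+s}}`. Then `conv{y(t) : t ∈ S}` is a facet of `C(d,n,s)` iff for any
two `u, v ∈ T∖S` the number of elements of `S` between `u` and `v` is even. -/
theorem acPolytope_gale_evenness (d n s : ℕ) (hd : 2 ≤ d) (hn : d + s < n)
    (S : Finset (Fin n)) (hcard : S.card = d)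
    (hnotI : ¬ ∀ j ∈ S, (j : ℕ) < d + s) :
    IsFacetOf (acPolytope d n s) (convexHull ℝ (acPoint d n s '' (S : Set (Fin n)))) ↔
      ∀ u v : Fin n, u ∉ S → v ∉ S →
        Even ((S.filter fun j : Fin n =>
          acT d s (u : ℕ) < acT d s (j : ℕ) ∧ acT d s (j : ℕ) < acT d s (v : ℕ)).card) := by
  obtain ⟨m, rfl⟩ : ∃ m, d = m + 1 := ⟨d - 1, by omega⟩
  have hne : ∀ u ∉ S, ∏ k ∈ S, (acT (m + 1) s (u : ℕ) - acT (m + 1) s (k : ℕ)) ≠ 0 := by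
    intro u hu
    refine Finset.prod_ne_zero_iff.2 fun k hk h => ?_
    exact hu ((acT_inj (m + 1) s n (sub_eq_zero.1 h) : u = k) ▸ hk)
  obtain ⟨u₀, hu₀⟩ : ∃ u₀, u₀ ∉ S := by
    by_contra h
    push Not at h
    have : S = Finset.univ := Finset.eq_univ_iff_forall.2 h
    rw [this, Finset.card_univ, Fintype.card_fin] at hcard
    omega
  constructor
  · rintro ⟨hF, hFne, -⟩ u v hu hv
    rcases lt_or_ge v u with hvu | huv
    · rw [Finset.filter_false_of_mem]
      · simp
      · rintro j - ⟨h1, h2⟩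
        have h1 := (acT_lt _ _).1 h1
        have h2 := (acT_lt _ _).1 h2
        have h3 : (v : ℕ) < u := hvu
        omega
    rw [even_iff _ _ _ _ _ _ huv hu hv]
    rcases hF with hF | hF | ⟨b, c, hb0, hle, hF⟩
    · rw [hF] at hFne
      exact absurd hFne Set.not_nonempty_empty
    · exfalso
      obtain ⟨b, c, -, hS, hb⟩ := exists_hyper m n s hd hn S hcard hnotI 1
      obtain ⟨D, hD, h⟩ := hb u₀ hu₀
      have hmem : acPoint (m + 1) n s u₀ ∈ convexHull ℝ (acPoint (m + 1) n s '' (S : Set (Fin n))) := by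
        rw [hF]
        exact subset_convexHull ℝ _ ⟨u₀, rfl⟩
      have := dotp_eq_of_hull _ S _ b c hS hmem
      rw [this, sub_self] at h
      exact mul_ne_zero (mul_ne_zero one_ne_zero hD.ne') (hne u₀ hu₀) h.symm
    · obtain ⟨Q, hdeg, hQ, hz⟩ := poly_of_hyper m n s b c
      have hS : ∀ j ∈ S, Q.eval (acT (m + 1) s (j : ℕ)) +
          b (Fin.last m) * acp (m + 1) n s (acT (m + 1) s (j : ℕ)) = 0 := by
        intro j hj
        have : acPoint (m + 1) n s j ∈ convexHull ℝ (acPoint (m + 1) n s '' (S : Set (Fin n))) :=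
          subset_convexHull ℝ _ ⟨j, hj, rfl⟩
        rw [hF] at this
        rw [← hQ, sub_eq_zero]
        exact this.2
      have he : b (Fin.last m) ≠ 0 := by
        intro he
        refine hb0 (hz he ?_)
        refine Polynomial.eq_zero_of_degree_lt_of_eval_index_eq_zero
          (s := S) (v := fun j : Fin n => acT (m + 1) s (j : ℕ))
          ((acT_inj (m + 1) s n).injOn) (by rw [hcard]; exact hdeg) ?_
        intro j hj
        have := hS j hj
        rwa [he, zero_mul, add_zero] at this
      have hsgn : ∀ u ∉ S, b (Fin.last m) *
          ∏ k ∈ S, (acT (m + 1) s (u : ℕ) - acT (m + 1) s (k : ℕ)) < 0 := by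
        intro u hu
        obtain ⟨D, hD, h⟩ := key_formula (m + 1) n s hd hn S hcard hnotI u hu
        have h1 := h Q _ hdeg hS
        rw [← hQ] at h1
        have h2 : dotp b (acPoint (m + 1) n s u) ≤ c :=
          hle _ (subset_convexHull ℝ _ ⟨u, rfl⟩)
        unfold acPoint at h2
        refine lt_of_le_of_ne ?_ (mul_ne_zero he (hne u hu))
        by_contra h3
        push Not at h3
        have := mul_pos hD h3
        nlinarith
      have := mul_pos_of_neg_of_neg (hsgn u hu) (hsgn v hv)
      have h2 : 0 < b (Fin.last m) ^ 2 := by positivity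
      refine pos_of_mul_pos_right (a := b (Fin.last m) ^ 2) ?_ h2.le
      linarith
  · intro hev
    have hpp : ∀ u ∉ S, 0 < (∏ k ∈ S, (acT (m + 1) s (u₀ : ℕ) - acT (m + 1) s (k : ℕ))) *
      ∏ k ∈ S, (acT (m + 1) s (u : ℕ) - acT (m + 1) s (k : ℕ)) := by
      intro u hu
      rcases le_total u₀ u with h | h
      · exact (even_iff _ _ _ _ _ _ h hu₀ hu).1 (hev u₀ u hu₀ hu)
      · rw [mul_comm]
        exact (even_iff _ _ _ _ _ _ h hu hu₀).1 (hev u u₀ hu hu₀)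
    set e : ℝ := - ∏ k ∈ S, (acT (m + 1) s (u₀ : ℕ) - acT (m + 1) s (k : ℕ)) with he
    have he0 : e ≠ 0 := neg_ne_zero.2 (hne u₀ hu₀)
    obtain ⟨b, c, hbe, hS, hb⟩ := exists_hyper m n s hd hn S hcard hnotI e
    have hlt : ∀ u ∉ S, dotp b (acPoint (m + 1) n s u) < c := by
      intro u hu
      obtain ⟨D, hD, h⟩ := hb u hu
      have h1 := mul_pos hD (hpp u hu)
      have h2 : e * D * ∏ k ∈ S, (acT (m + 1) s (u : ℕ) - acT (m + 1) s (k : ℕ)) < 0 := by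
        rw [he]; linarith
      linarith
    refine ⟨Or.inr (Or.inr ⟨b, c, ?_, ?_, face_eq _ S b c hS hlt⟩), ?_, ?_⟩
    · rintro rfl
      exact he0 hbe.symm
    · intro x hx
      unfold acPolytope at hx
      rw [← Set.image_univ, ← Finset.coe_univ] at hx
      refine dotp_le_of_hull _ Finset.univ x b c (fun i _ => ?_) hx
      by_cases hi : i ∈ S
      · exact (hS i hi).le
      · exact (hlt i hi).le
    · obtain ⟨j, hj⟩ : S.Nonempty := Finset.card_pos.1 (by omega)
      exact ⟨_, subset_convexHull ℝ _ ⟨j, hj, rfl⟩⟩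
    · rw [dim_eq m n s S hcard]
      rfl

end

end ASP
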